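/- arXiv:2406.06078 — 12 statements merged into one kernel-verified Lean document; each statement's English description precedes it below -/
import Mathlib

section
/- Let A be a commutative ring, U a subset of A, and x, y ∈ A. If xy belongs to the radical of the ideal generated by U and x belongs to the radical of the ideal generated by U ∪ {y}, then x belongs to the radical of the ideal generated by U. -/
/-- If `x*y ∈ Nil U` and `x ∈ Nil (U ∪ {y})`, then `x ∈ Nil U`. -/
theorem mem_radical_of_mem_radical_insert {A : Type*} [CommRing A]
    (U : Set A) (x y : A)
    (h1 : x * y ∈ (Ideal.span U).radical)
    (h2 : x ∈ (Ideal.span (U ∪ {y})).radical) :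
    x ∈ (Ideal.span U).radical := by
  obtain ⟨n, hn⟩ := h2
  rw [Ideal.span_union] at hn
  obtain ⟨u, hu, v, hv, huv⟩ := Submodule.mem_sup.mp hn
  obtain ⟨a, rfl⟩ := Ideal.mem_span_singleton'.mp hv
  rw [← Ideal.radical_idem]
  refine ⟨n + 1, ?_⟩
  have key : x ^ (n + 1) = x * u + a * (x * y) := by
    rw [pow_succ, ← huv]
    ring
  rw [key]
  exact add_mem (Ideal.mul_mem_left _ _ (Ideal.le_radical hu)) (Ideal.mul_mem_left _ _ h1)
end

section
/- Let A be a commutative ring, U a subset of A, and x, y ∈ A. If for every z ∈ A the element x lies in the Jacobson radical of the ideal generated by U ∪ {1 − yz}, then xy lies in the Jacobson radical of the ideal generated by U. -/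
/-- If `x ∈ Jac (U ∪ {1 - y*z})` for all `z`, then `x*y ∈ Jac U`. -/
theorem mul_mem_jacobson_of_forall {A : Type*} [CommRing A]
    (U : Set A) (x y : A)
    (h : ∀ z : A, x ∈ (Ideal.span (U ∪ {1 - y * z})).jacobson) :
    x * y ∈ (Ideal.span U).jacobson := by
  rw [Ideal.mem_jacobson_iff]
  intro b
  obtain ⟨w, hw⟩ := Ideal.mem_jacobson_iff.1 (h (-(b * x))) (b * y)
  rw [Set.union_singleton, Ideal.mem_span_insert] at hw
  obtain ⟨a, u, hu, hw⟩ := hw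
  refine ⟨w - a, ?_⟩
  convert hu using 1
  linear_combination hw
end

section
/- Let A be a commutative ring of Krull dimension at most 1. If an ideal I of A contains a regular element (nonzerodivisor), then Jac I ⊆ Nil I. -/
/-- Let `A` be a commutative ring with Krull dimension at most 1.
If an ideal `I` of `A` contains a regular element, then `Jac I ⊆ Nil I`. -/
theorem kdim1_jacobson_lemma {A : Type*} [CommRing A]
    (hA : ringKrullDim A ≤ 1) (I : Ideal A)
    (hI : ∃ x ∈ I, x ∈ nonZeroDivisors A) :
    I.jacobson ≤ I.radical := by
  obtain ⟨x, hxI, hx⟩ := hI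
  have hdim : Ring.KrullDimLE 1 A := Ring.krullDimLE_iff.mpr (by exact_mod_cast hA)
  rw [Ideal.radical_eq_sInf]
  refine le_sInf fun p ⟨hIp, hp⟩ ↦ ?_
  have hmax : p.IsMaximal := (Ring.krullDimLE_one_iff.mp hdim p hp).resolve_left fun hmin ↦
    notMem_nonZeroDivisors_of_mem_mem_minimalPrimes (hIp hxI) hmin hx
  exact sInf_le ⟨hIp, hmax⟩
end

section
/- Let A be a commutative ring satisfying: (1) every element of A is nilpotent or a regular element (nonzerodivisor); (2) the Krull dimension of A is at most 1; and (3) for every ideal I of A, if Jac I contains a regular element then I contains a regular element. Then A is a Jacobson ring. -/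
/-- If every element of `A` is nilpotent or regular, `ringKrullDim A ≤ 1`,
and for every ideal `I`, `Jac I` containing a regular element implies `I` contains a
regular element, then `A` is Jacobson. -/
theorem kdim1_jacobson {A : Type*} [CommRing A]
    (h1 : ∀ a : A, IsNilpotent a ∨ a ∈ nonZeroDivisors A)
    (h2 : ringKrullDim A ≤ 1)
    (h3 : ∀ I : Ideal A, (∃ x ∈ I.jacobson, x ∈ nonZeroDivisors A) →
      ∃ x ∈ I, x ∈ nonZeroDivisors A) :
    ∀ I : Ideal A, I.jacobson ≤ I.radical := by
  intro I a ha
  rcases h1 a with hnil | hreg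
  · obtain ⟨n, hn⟩ := hnil
    exact ⟨n, hn ▸ I.zero_mem⟩
  obtain ⟨x, hxI, hx⟩ := h3 I ⟨a, ha, hreg⟩
  have : Ring.KrullDimLE 1 A := Ring.krullDimLE_iff.mpr (by exact_mod_cast h2)
  rw [Ideal.radical_eq_sInf, Ideal.mem_sInf]
  rintro p ⟨hIp, hp⟩
  rcases Ring.krullDimLE_one_iff.mp this p hp with hmin | hmax
  · exact absurd hx
      (Set.disjoint_left.mp (Ideal.disjoint_nonZeroDivisors_of_mem_minimalPrimes hmin) (hIp hxI))
  · exact Ideal.mem_sInf.mp ha ⟨hIp, hmax⟩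
end

section
/- Let A be a commutative ring such that (1) every element of A is nilpotent or a regular element (nonzerodivisor), and (2) the Jacobson radical of the zero ideal of A is contained in the nilradical of A. Then for every ideal I of A, if Jac I contains a regular element, then I contains a regular element. (The paper proves the double negation of the conclusion, which is classically equivalent.) -/
/-- If every element of `A` is nilpotent or regular and
`Jac 0 ⊆ Nil 0`, then for every ideal `I`, if `Jac I` contains a regular element
then `I` contains a regular element. -/
theorem simplify_kdim1_jacobson {A : Type*} [CommRing A]
    (h1 : ∀ a : A, IsNilpotent a ∨ a ∈ nonZeroDivisors A)
    (h2 : (⊥ : Ideal A).jacobson ≤ (⊥ : Ideal A).radical) :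
    ∀ I : Ideal A, (∃ x ∈ I.jacobson, x ∈ nonZeroDivisors A) →
      ∃ x ∈ I, x ∈ nonZeroDivisors A := by
  rintro I ⟨x, hxI, hx⟩
  by_contra! hI
  have hnil : I ≤ (⊥ : Ideal A).radical := fun a ha ↦
    mem_nilradical.mpr ((h1 a).resolve_right (hI a ha))
  have hjac : I.jacobson ≤ (⊥ : Ideal A).jacobson := by
    simpa only [Ideal.jacobson_idem] using
      Ideal.jacobson_mono (hnil.trans Ideal.radical_le_jacobson)
  obtain ⟨n, hn⟩ : IsNilpotent x := mem_nilradical.mp (h2 (hjac hxI))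
  exact hI 0 I.zero_mem (hn ▸ pow_mem hx n)
end

section
/- Let A be a commutative ring satisfying: (1) every element of A is nilpotent or a regular element (nonzerodivisor); (2) the Krull dimension of A is at most 1; and (3) the Jacobson radical of the zero ideal of A is contained in the nilradical of A. Then A is a Jacobson ring. -/
theorem Ideal.le_nilradical_of_mem_minimalPrimes {A : Type*} [CommRing A]
    (h : ∀ a : A, IsNilpotent a ∨ a ∈ nonZeroDivisors A) {P : Ideal A}
    (hP : P ∈ minimalPrimes A) : P ≤ nilradical A := fun a ha ↦
  (h a).resolve_right (notMem_nonZeroDivisors_of_mem_mem_minimalPrimes ha hP)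

/-- If every element of `A` is nilpotent or regular, `ringKrullDim A ≤ 1`,
and `Jac 0 ⊆ Nil 0`, then `A` is Jacobson. -/
theorem fin_kdim1_jacobson {A : Type*} [CommRing A]
    (h1 : ∀ a : A, IsNilpotent a ∨ a ∈ nonZeroDivisors A)
    (h2 : ringKrullDim A ≤ 1)
    (h3 : (⊥ : Ideal A).jacobson ≤ (⊥ : Ideal A).radical) :
    ∀ I : Ideal A, I.jacobson ≤ I.radical := by
  have : Ring.KrullDimLE 1 A := Ring.krullDimLE_iff.mpr (mod_cast h2)
  intro I
  rw [Ideal.radical_eq_sInf]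
  refine le_sInf fun P ⟨hIP, hP⟩ ↦ ?_
  rcases Ring.krullDimLE_one_iff.mp this P hP with hmin | hmax
  · have hI : I ≤ (⊥ : Ideal A).jacobson :=
      hIP.trans <| (Ideal.le_nilradical_of_mem_minimalPrimes h1 hmin).trans
        Ideal.radical_le_jacobson
    calc I.jacobson ≤ (⊥ : Ideal A).jacobson.jacobson := Ideal.jacobson_mono hI
      _ = (⊥ : Ideal A).jacobson := Ideal.jacobson_idem
      _ ≤ (⊥ : Ideal A).radical := h3
      _ ≤ P := hP.radical_le_iff.mpr bot_le
  · exact sInf_le ⟨hIP, hmax⟩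
end

section
/- (Snapper's theorem) For every commutative ring A, the Jacobson radical of the zero ideal of the polynomial ring A[X] is contained in the nilradical of A[X]; that is, every element of the Jacobson radical of A[X] is nilpotent. -/
/-- Snapper's theorem: For every commutative ring `A`, the Jacobson
radical of the zero ideal of `A[X]` is contained in the nilradical of `A[X]`. -/
theorem polynomial_jac_le_nil (A : Type*) [CommRing A] :
    (⊥ : Ideal (Polynomial A)).jacobson ≤ (⊥ : Ideal (Polynomial A)).radical := by
  intro f hf
  have hunit : IsUnit (f * Polynomial.X + 1) := Ideal.mem_jacobson_bot.mp hf Polynomial.X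
  have hcoeff := (Polynomial.isUnit_iff_coeff_isUnit_isNilpotent.mp hunit).2
  change f ∈ nilradical (Polynomial A)
  rw [mem_nilradical, Polynomial.isNilpotent_iff]
  intro i
  simpa [Polynomial.coeff_one] using hcoeff (i + 1) i.succ_ne_zero
end

section
/- Let A be a commutative ring, a ∈ A, and let B be a commutative ring extension of A (i.e., A is a subring of B, or equivalently the structure map A → B is injective) such that the localization B[1/a] is integral over A[1/a] (the induced map of localizations away from a is an integral ring homomorphism). Then for every a′ ∈ A lying in the Jacobson radical of the zero ideal of B, the element a·a′ lies in the Jacobson radical of the zero ideal of A. -/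
/-- Let `B` be a ring extension of `A` (the structure map is injective),
`a ∈ A`, and suppose `B[1/a]` is integral over `A[1/a]`. Then for every `a' ∈ A` whose
image lies in the Jacobson radical of the zero ideal of `B`, the element `a * a'` lies
in the Jacobson radical of the zero ideal of `A`. -/
theorem quitte_lemma {A B : Type*} [CommRing A] [CommRing B] [Algebra A B]
    (hinj : Function.Injective (algebraMap A B)) (a : A)
    (hint : (Localization.awayMap (algebraMap A B : A →+* B) a).IsIntegral) :
    ∀ a' : A, algebraMap A B a' ∈ (⊥ : Ideal B).jacobson →
      a * a' ∈ (⊥ : Ideal A).jacobson := by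
  intro a' ha'
  rw [Ideal.mem_jacobson_bot] at ha' ⊢
  intro y
  have hB : IsUnit (algebraMap A B (a * a' * y + 1)) := by
    convert ha' (algebraMap A B (a * y)) using 1
    simp only [map_add, map_mul, map_one]
    ring
  have hlocal := hint.isLocalHom
    (Localization.awayMap_injective_iff.mpr fun x hx =>
      ⟨0, by rw [(injective_iff_map_eq_zero _).mp hinj x hx, mul_zero]⟩)
  have hA : IsUnit (algebraMap A (Localization.Away a) (a * a' * y + 1)) := by
    refine hlocal.map_nonunit _ ?_
    rw [Localization.awayMap, IsLocalization.Away.map, IsLocalization.map_eq]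
    exact hB.map _
  obtain ⟨n, hn⟩ := (IsLocalization.Away.algebraMap_isUnit_iff a).mp hA
  have hcop : IsCoprime (a * a' * y + 1) a := ⟨1, -(a' * y), by ring⟩
  exact (hcop.pow_right (n := n)).isUnit_of_dvd hn
end

section
/- Let A be a Jacobson commutative ring, a ∈ A, and let B be a commutative A-algebra with structure map φ : A → B such that the localization B[1/φ(a)] is integral over A[1/a] (the induced map of localizations away from a is an integral ring homomorphism). Then for every ideal J of B and every f in the Jacobson radical Jac J, the element φ(a)·f lies in the radical Nil J. -/
/-- Let `A` be a Jacobson ring and `φ : A → B` a ring homomorphism whose localization away from `a`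
is integral. Then maximal ideals of `B[1/φ(a)]` contract to maximal ideals of `B`. -/
theorem Ideal.isMaximal_comap_of_isIntegral_awayMap {A B : Type*} [CommRing A] [CommRing B]
    [IsJacobsonRing A] (φ : A →+* B) (a : A) (h : (Localization.awayMap φ a).IsIntegral)
    (M : Ideal (Localization.Away (φ a))) [hM : M.IsMaximal] :
    (M.comap (algebraMap B (Localization.Away (φ a)))).IsMaximal := by
  set ψ := Localization.awayMap φ a
  set m := M.comap (algebraMap B (Localization.Away (φ a)))
  have hcomm : ψ.comp (algebraMap A (Localization.Away a)) =
      (algebraMap B (Localization.Away (φ a))).comp φ := IsLocalization.map_comp _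
  have hN : (M.comap ψ).IsMaximal := isMaximal_comap_of_isIntegral_of_isMaximal' ψ h M
  have hn : ((M.comap ψ).under A).IsMaximal :=
    ((IsLocalization.isMaximal_iff_isMaximal_disjoint (Localization.Away a) a _).1 hN).1
  have hmn : (m.comap φ).IsMaximal := by
    rwa [Ideal.comap_comap, ← hcomm, ← Ideal.comap_comap]
  have hsurj := IsLocalization.surjective_quotientMap_of_maximal_of_localization
    (Submonoid.powers a) (Localization.Away a) (H := le_rfl) hn
  have hA : ((Ideal.quotientMap M ψ le_rfl).comp
      ((Ideal.quotientMap (M.comap ψ) (algebraMap A (Localization.Away a)) le_rfl).comp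
        (Ideal.Quotient.mk _))).IsIntegral := by
    refine RingHom.IsIntegral.trans (RingHom.comp _ _) _ (RingHom.isIntegral_of_surjective _ ?_)
      (RingHom.IsIntegral.quotient ψ h)
    exact hsurj.comp Ideal.Quotient.mk_surjective
  have hint : ((Ideal.Quotient.mk m).comp φ).IsIntegral := by
    refine RingHom.IsIntegral.tower_bot _ (Ideal.quotientMap M _ le_rfl)
      Ideal.quotientMap_injective ?_
    refine (congrArg RingHom.IsIntegral (RingHom.ext fun x => ?_)).mpr hA
    exact congrArg (Ideal.Quotient.mk M) (RingHom.congr_fun hcomm x).symm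
  have : m.IsPrime := Ideal.comap_isPrime _ M
  rw [← Ideal.bot_quotient_isMaximal_iff]
  refine Ideal.isMaximal_of_isIntegral_of_isMaximal_comap' _ hint _ ?_
  rwa [← Ideal.comap_comap, ← RingHom.ker_eq_comap_bot, Ideal.mk_ker]

/-- key lemma, generalizing Emerton's lemma: Let `A` be a Jacobson ring,
`a ∈ A`, and `B` an `A`-algebra such that `B[1/φ(a)]` is integral over `A[1/a]`, where
`φ : A → B` is the structure map. Then for every ideal `J` of `B` and every
`f ∈ Jac J`, we have `φ(a) * f ∈ Nil J`. -/
theorem emerton_key_lemma {A B : Type*} [CommRing A] [CommRing B] [Algebra A B]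
    (hA : ∀ I : Ideal A, I.jacobson ≤ I.radical) (a : A)
    (hint : (Localization.awayMap (algebraMap A B : A →+* B) a).IsIntegral) :
    ∀ J : Ideal B, ∀ f ∈ J.jacobson, algebraMap A B a * f ∈ J.radical := by
  intro J f hf
  have : IsJacobsonRing A :=
    isJacobsonRing_iff.2 fun I hI => ((hA I).trans hI).antisymm Ideal.le_jacobson
  set b := algebraMap A B a
  let ι := algebraMap B (Localization.Away b)
  have : IsJacobsonRing (Localization.Away a) := isJacobsonRing_localization a
  have : IsJacobsonRing (Localization.Away b) := isJacobsonRing_of_isIntegral' _ hint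
  have hf' : ι f ∈ (J.map ι).radical := by
    rw [Ideal.radical_eq_jacobson]
    refine Ideal.mem_sInf.2 fun {M} ⟨hJM, hM⟩ => ?_
    exact Ideal.mem_sInf.1 hf ⟨Ideal.map_le_iff_le_comap.1 hJM,
      Ideal.isMaximal_comap_of_isIntegral_awayMap _ a hint M⟩
  obtain ⟨n, hn⟩ := hf'
  rw [← map_pow, IsLocalization.algebraMap_mem_map_algebraMap_iff (Submonoid.powers b)] at hn
  obtain ⟨_, ⟨k, rfl⟩, hk⟩ := hn
  refine ⟨k + n, ?_⟩
  have : (b * f) ^ (k + n) = b ^ n * f ^ k * (b ^ k * f ^ n) := by ring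
  rw [this]
  exact J.mul_mem_left _ hk
end

section
/- Let A be the polynomial ring ℚ[X_k : k ∈ ℕ] in countably infinitely many variables over ℚ. Then A is finitely Jacobson (for every finitely generated ideal I of A, Jac I ⊆ Nil I), but A is not a Jacobson ring (there exists an ideal I of A with Jac I ⊄ Nil I). -/
/-- Over infinitely many variables, the Jacobson radical of a finitely generated ideal is contained
in its radical: if `a` lies in the former and `X i` occurs neither in `a` nor in the generators,
then `1 + X i * a` is invertible modulo `I`, and substituting `-1 / a` for `X i` shows that
`MvPolynomial σ R ⧸ I` localized away from `a` is trivial. -/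
theorem MvPolynomial.jacobson_le_radical_of_fg {σ R : Type*} [Infinite σ] [CommRing R]
    {I : Ideal (MvPolynomial σ R)} (hI : I.FG) : I.jacobson ≤ I.radical := by
  classical
  intro a ha
  obtain ⟨G, rfl⟩ := hI
  set I := Ideal.span (G : Set (MvPolynomial σ R))
  obtain ⟨i, hi⟩ := Infinite.exists_notMem_finset (a.vars ∪ G.biUnion vars)
  simp only [Finset.mem_union, Finset.mem_biUnion, not_or, not_exists, not_and] at hi
  obtain ⟨z, hz⟩ := Ideal.mem_jacobson_iff.1 ha (X i)
  let q := Ideal.Quotient.mk I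
  let B := Localization.Away (q a)
  let c : MvPolynomial σ R →+* B := (algebraMap _ B).comp q
  let φ : MvPolynomial σ R →+* B := eval₂Hom (c.comp C)
    fun k ↦ if k = i then -IsLocalization.Away.invSelf (q a) else c (X k)
  have hφ : ∀ p : MvPolynomial σ R, i ∉ p.vars → φ p = c p := fun p hp ↦ by
    refine hom_congr_vars ?_ (fun k hk _ ↦ ?_) rfl
    · ext; simp [φ]
    · have : k ≠ i := by rintro rfl; exact hp hk
      simp [φ, this]
  have hφI : I ≤ RingHom.ker φ := Ideal.span_le.2 fun g hg ↦ by
    have : q g = 0 := Ideal.Quotient.eq_zero_iff_mem.2 (Ideal.subset_span hg)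
    simp [RingHom.mem_ker, hφ g (hi.2 g hg), c, this]
  have h₁ : φ (X i) * φ a = -1 := by
    have := IsLocalization.Away.mul_invSelf (S := B) (q a)
    rw [hφ a hi.1]
    simp only [φ, c, eval₂Hom_X', if_true, RingHom.comp_apply]
    linear_combination -this
  have h₂ : (0 : B) = 1 := by
    have h := RingHom.mem_ker.1 (hφI hz)
    simp only [map_sub, map_add, map_mul, map_one] at h
    linear_combination h - φ z * h₁
  have h₃ : (0 : MvPolynomial σ R ⧸ I) ∈ Submonoid.powers (q a) :=
    (IsLocalization.subsingleton_iff (S := B)).1 (subsingleton_of_zero_eq_one h₂)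
  obtain ⟨n, hn⟩ := h₃
  exact ⟨n, Ideal.Quotient.eq_zero_iff_mem.1 (by simpa [q] using hn)⟩

/-- A Jacobson local domain is a field. -/
theorem IsLocalRing.isField_of_isJacobsonRing {R : Type*} [CommRing R] [IsDomain R]
    [IsLocalRing R] [IsJacobsonRing R] : IsField R := by
  rw [IsLocalRing.isField_iff_maximalIdeal_eq, ← IsLocalRing.jacobson_eq_maximalIdeal ⊥ bot_ne_top,
    ← Ideal.radical_eq_jacobson]
  exact (Ideal.isPrime_bot (α := R)).radical

/-- A countable local domain that is not a field, such as `K[X]` localized at `(X)`, is a quotient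
of the polynomial ring over `K` in infinitely many variables, which is hence not Jacobson. -/
theorem MvPolynomial.not_isJacobsonRing_of_countable {σ K : Type*} [Infinite σ] [Field K]
    [Countable K] : ¬ IsJacobsonRing (MvPolynomial σ K) := by
  intro h
  let P : Ideal (Polynomial K) := Ideal.span {Polynomial.X}
  have hP : P.IsPrime := (Ideal.span_singleton_prime Polynomial.X_ne_zero).2 Polynomial.prime_X
  let B := Localization.AtPrime P
  have : Countable (Polynomial K) := Cardinal.mk_le_aleph0_iff.1 <|
    Polynomial.cardinalMk_le_max.trans (max_le Cardinal.mk_le_aleph0 le_rfl)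
  have : Countable B := (IsLocalization.mk'_surjective P.primeCompl).countable
  obtain ⟨f, hf⟩ : ∃ f : σ → B, Function.Surjective f := by
    obtain ⟨g, hg⟩ := exists_surjective_nat B
    exact ⟨g ∘ Function.invFun (Infinite.natEmbedding σ),
      hg.comp (Function.invFun_surjective (Infinite.natEmbedding σ).injective)⟩
  have hJ : IsJacobsonRing B := isJacobsonRing_of_surjective
    ⟨(aeval (R := K) f).toRingHom, fun b ↦ by
      obtain ⟨k, rfl⟩ := hf b
      exact ⟨X k, aeval_X f k⟩⟩
  have : IsDomain B := IsLocalization.isDomain_localization P.primeCompl_le_nonZeroDivisors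
  exact IsLocalization.AtPrime.not_isField (Polynomial K) (P := P) (by simp [P]) B
    IsLocalRing.isField_of_isJacobsonRing

/-- The polynomial ring `ℚ[X_k : k ∈ ℕ]` in countably infinitely many
variables over `ℚ` is finitely Jacobson (Jac I ⊆ Nil I for every finitely generated
ideal I), but not Jacobson (some ideal I has Jac I ⊄ Nil I). -/
theorem mvPolynomial_finitely_jacobson_not_jacobson :
    (∀ I : Ideal (MvPolynomial ℕ ℚ), I.FG → I.jacobson ≤ I.radical) ∧
    (∃ I : Ideal (MvPolynomial ℕ ℚ), ¬ I.jacobson ≤ I.radical) := by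
  refine ⟨fun _ ↦ MvPolynomial.jacobson_le_radical_of_fg, ?_⟩
  by_contra! h
  exact MvPolynomial.not_isJacobsonRing_of_countable (σ := ℕ) (K := ℚ)
    ⟨fun {I} hI ↦ le_antisymm ((h I).trans_eq hI.radical) Ideal.le_jacobson⟩
end

section
/- If I is a finitely generated ideal of a finitely Jacobson commutative ring A, then the quotient ring A/I is finitely Jacobson. -/
/-- If `I` is a finitely generated ideal of a finitely Jacobson
commutative ring `A`, then `A/I` is finitely Jacobson. -/
theorem fin_quotient_jacobson {A : Type*} [CommRing A]
    (hA : ∀ I : Ideal A, I.FG → I.jacobson ≤ I.radical)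
    (I : Ideal A) (hI : I.FG) :
    ∀ J : Ideal (A ⧸ I), J.FG → J.jacobson ≤ J.radical := by
  intro J hJ
  have hsurj : Function.Surjective (Ideal.Quotient.mk I) := Ideal.Quotient.mk_surjective
  have hfg : (J.comap (Ideal.Quotient.mk I)).FG := by
    have h := Ideal.fg_ker_comp (Ideal.Quotient.mk I) (Ideal.Quotient.mk J)
      (by rwa [Ideal.mk_ker]) (by rwa [Ideal.mk_ker]) hsurj
    rwa [← RingHom.comap_ker, Ideal.mk_ker] at h
  have h := hA _ hfg
  rw [← Ideal.comap_jacobson_of_surjective hsurj, ← Ideal.comap_radical] at h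
  exact (Ideal.comap_le_comap_iff_of_surjective _ hsurj _ _).mp h
end

section
/- Let A be a finitely Jacobson commutative ring satisfying the contraction property, i.e., for every finitely generated ideal J of the polynomial ring A[X], the contraction of J to A (the preimage of J under the coefficient embedding C : A → A[X]) is a finitely generated ideal of A. Then A[X] is finitely Jacobson. -/
open PrimeSpectrum in
/-- If `I.jacobson ≤ I.radical` for all finitely generated ideals `I`, then closed points are dense
in the constructible topology. -/
theorem exists_isMaximal_mem_of_isConstructible {A : Type*} [CommRing A]
    (hA : ∀ I : Ideal A, I.FG → I.jacobson ≤ I.radical)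
    {s : Set (PrimeSpectrum A)} (hs : Topology.IsConstructible s) (hne : s.Nonempty) :
    ∃ m ∈ s, m.asIdeal.IsMaximal := by
  obtain ⟨S, rfl⟩ := exists_constructibleSetData_iff.mpr hs
  obtain ⟨p, hp⟩ := hne
  simp only [ConstructibleSetData.toSet, Set.mem_iUnion] at hp
  obtain ⟨D, hD, hpg, hpf⟩ := hp
  have hf : D.f ∉ (Ideal.span (Set.range D.g)).jacobson := fun h ↦ by
    refine hpf ?_
    have := (p.2.radical_le_iff.mpr (Ideal.span_le.mpr hpg))
      (hA _ ⟨(Set.finite_range D.g).toFinset, by simp⟩ h)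
    simpa [mem_zeroLocus] using this
  simp only [Ideal.jacobson, Ideal.mem_sInf, not_forall] at hf
  obtain ⟨m, ⟨hgm, hm⟩, hfm⟩ := hf
  refine ⟨⟨m, hm.isPrime⟩, ?_, hm⟩
  simp only [ConstructibleSetData.toSet, Set.mem_iUnion]
  exact ⟨D, hD, Ideal.span_le.mp hgm, by simpa [mem_zeroLocus] using hfm⟩

open Polynomial in
/-- In the fibre of `Spec A[X]` over a closed point, closed points are dense in every closed set. -/
theorem Polynomial.exists_isMaximal_of_isMaximal_comap_C {A : Type*} [CommRing A]
    (Q : Ideal A[X]) [Q.IsPrime] (hm : (Q.comap C).IsMaximal) {f : A[X]} (hf : f ∉ Q) :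
    ∃ N : Ideal A[X], N.IsMaximal ∧ Q ≤ N ∧ f ∉ N := by
  let _ := Ideal.Quotient.field (Q.comap C)
  let φ := mapRingHom (Ideal.Quotient.mk (Q.comap C))
  have hφ : Function.Surjective φ := map_surjective _ Ideal.Quotient.mk_surjective
  have hker : RingHom.ker φ ≤ Q := by
    rw [ker_mapRingHom, Ideal.mk_ker]
    exact Ideal.map_comap_le
  have hQ : (Q.map φ).comap φ = Q := by
    rw [Ideal.comap_map_of_surjective' φ hφ, sup_eq_left.mpr hker]
  have : (Q.map φ).IsPrime := Ideal.map_isPrime_of_surjective hφ hker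
  have hfφ : φ f ∉ (Q.map φ).jacobson := by
    rw [← Ideal.radical_eq_jacobson, this.radical, ← Ideal.mem_comap, hQ]
    exact hf
  simp only [Ideal.jacobson, Ideal.mem_sInf, not_forall] at hfφ
  obtain ⟨N, ⟨hQN, hN⟩, hfN⟩ := hfφ
  exact ⟨N.comap φ, Ideal.comap_isMaximal_of_surjective φ hφ, Ideal.map_le_iff_le_comap.mp hQN, hfN⟩


/-- If `A` is a finitely Jacobson commutative ring satisfying the
contraction property (the contraction to `A` of every finitely generated ideal of
`A[X]` is finitely generated), then `A[X]` is finitely Jacobson. -/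
theorem fin_general_nullstellensatz {A : Type*} [CommRing A]
    (hA : ∀ I : Ideal A, I.FG → I.jacobson ≤ I.radical)
    (hCP : ∀ J : Ideal (Polynomial A), J.FG →
      (J.comap (Polynomial.C : A →+* Polynomial A)).FG) :
    ∀ J : Ideal (Polynomial A), J.FG → J.jacobson ≤ J.radical := by
  rintro J ⟨t, rfl⟩ f hf
  by_contra hrad
  simp only [Ideal.radical_eq_sInf, Ideal.mem_sInf, not_forall] at hrad
  obtain ⟨P, ⟨hJP, hP⟩, hfP⟩ := hrad
  let s := PrimeSpectrum.zeroLocus (t : Set (Polynomial A)) \ PrimeSpectrum.zeroLocus {f}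
  have hconstr {u : Set (Polynomial A)} (hu : u.Finite) :
      Topology.IsConstructible (PrimeSpectrum.zeroLocus u) := by
    rw [← Topology.isConstructible_compl]
    exact (PrimeSpectrum.isRetrocompact_zeroLocus_compl hu).isConstructible
      (PrimeSpectrum.isClosed_zeroLocus _).isOpen_compl
  have hs : Topology.IsConstructible s :=
    (hconstr t.finite_toSet).sdiff (hconstr (Set.finite_singleton f))
  have hC : (Polynomial.C : A →+* Polynomial A).FinitePresentation :=
    RingHom.finitePresentation_algebraMap.mpr (Algebra.FinitePresentation.polynomial A A)
  have himage := PrimeSpectrum.isConstructible_comap_image hC hs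
  obtain ⟨_, ⟨Q, ⟨hJQ, hfQ⟩, rfl⟩, hm⟩ := exists_isMaximal_mem_of_isConstructible hA himage
    ⟨_, ⟨P, hP⟩, ⟨Ideal.span_le.mp hJP, by simpa [PrimeSpectrum.mem_zeroLocus] using hfP⟩, rfl⟩
  obtain ⟨N, hN, hQN, hfN⟩ := Polynomial.exists_isMaximal_of_isMaximal_comap_C Q.asIdeal hm
    (f := f) (by simpa [PrimeSpectrum.mem_zeroLocus] using hfQ)
  exact hfN (Ideal.mem_sInf.mp hf ⟨(Ideal.span_le.mpr hJQ).trans hQN, hN⟩)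
end
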